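/- With B, C and E a regular separability idempotent with antipodal maps S_B, S_C as in the context, set F = (id_B ⊗ S_C)(E) ∈ B ⊗ B. Then m_B(F) = 1, where m_B : B ⊗ B → B is the multiplication map, and (b ⊗ 1)·F = F·(1 ⊗ b) in B ⊗ B for all b ∈ B; that is, F is a separability element for B in the classical sense. -/

import Mathlib

open TensorProduct

/-- Slice map `id ⊗ ω` landing in the left tensor factor. -/
noncomputable def sL {B C : Type} [AddCommGroup B] [Module ℂ B] [AddCommGroup C] [Module ℂ C]
    (ω : C →ₗ[ℂ] ℂ) : (B ⊗[ℂ] C) →ₗ[ℂ] B :=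
  (TensorProduct.rid ℂ B).toLinearMap ∘ₗ LinearMap.lTensor B ω

/-- Slice map `ω ⊗ id` landing in the right tensor factor. -/
noncomputable def sR {B C : Type} [AddCommGroup B] [Module ℂ B] [AddCommGroup C] [Module ℂ C]
    (ω : B →ₗ[ℂ] ℂ) : (B ⊗[ℂ] C) →ₗ[ℂ] C :=
  (TensorProduct.lid ℂ C).toLinearMap ∘ₗ LinearMap.rTensor C ω

lemma sL_tmul_one_mul {B C : Type} [Ring B] [Algebra ℂ B] [Ring C] [Algebra ℂ C]
    (ω : C →ₗ[ℂ] ℂ) (b : B) (T : B ⊗[ℂ] C) :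
    sL ω ((b ⊗ₜ[ℂ] (1 : C)) * T) = b * sL ω T := by
  induction T with
  | zero => simp
  | tmul x y => simp [sL]
  | add x y hx hy => simp only [mul_add, map_add, hx, hy]

/-- If `(1 ⊗ c) E = (S c ⊗ 1) E` for all `c`, then left multiplication of `E` by `T` agrees with
left multiplication by `m ((id ⊗ S) T) ⊗ 1`. -/
lemma mul_eq_mul'_map_tmul_one_mul {B C : Type} [Ring B] [Algebra ℂ B] [Ring C] [Algebra ℂ C]
    {E : B ⊗[ℂ] C} {S : C →ₗ[ℂ] B}
    (hS : ∀ c : C, ((1 : B) ⊗ₜ[ℂ] c) * E = (S c ⊗ₜ[ℂ] (1 : C)) * E) (T : B ⊗[ℂ] C) :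
    T * E = (LinearMap.mul' ℂ B (TensorProduct.map LinearMap.id S T) ⊗ₜ[ℂ] (1 : C)) * E := by
  induction T with
  | zero => simp
  | tmul x y =>
    have hxy : x ⊗ₜ[ℂ] y = (x ⊗ₜ[ℂ] (1 : C)) * ((1 : B) ⊗ₜ[ℂ] y) := by simp
    rw [hxy, mul_assoc, hS, ← mul_assoc]
    simp
  | add x y hx hy => simp only [add_mul, map_add, TensorProduct.add_tmul, hx, hy]

lemma map_tmul_one_mul {B C : Type} [Ring B] [Algebra ℂ B] [Ring C] [Algebra ℂ C]
    (S : C →ₗ[ℂ] B) (b : B) (T : B ⊗[ℂ] C) :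
    TensorProduct.map LinearMap.id S ((b ⊗ₜ[ℂ] (1 : C)) * T) =
      (b ⊗ₜ[ℂ] (1 : B)) * TensorProduct.map LinearMap.id S T := by
  induction T with
  | zero => simp
  | tmul x y => simp
  | add x y hx hy => simp only [mul_add, map_add, hx, hy]

lemma map_one_tmul_mul {B C : Type} [Ring B] [Algebra ℂ B] [Ring C] [Algebra ℂ C]
    {S : C →ₗ[ℂ] B} (hS : ∀ c c' : C, S (c * c') = S c' * S c) (c : C) (T : B ⊗[ℂ] C) :
    TensorProduct.map LinearMap.id S (((1 : B) ⊗ₜ[ℂ] c) * T) =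
      TensorProduct.map LinearMap.id S T * ((1 : B) ⊗ₜ[ℂ] S c) := by
  induction T with
  | zero => simp
  | tmul x y => simp [hS]
  | add x y hx hy => simp only [mul_add, add_mul, map_add, hx, hy]

theorem statement6
    (B C : Type) [Ring B] [Algebra ℂ B] [Ring C] [Algebra ℂ C]
    (E : B ⊗[ℂ] C) (hEE : E * E = E)
    (hfullB : Submodule.span ℂ {x : B | ∃ ω : C →ₗ[ℂ] ℂ, x = sL ω E} = ⊤)
    (hfullC : Submodule.span ℂ {y : C | ∃ ω : B →ₗ[ℂ] ℂ, y = sR ω E} = ⊤)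
    (SB : B ≃ₗ[ℂ] C) (SC : C ≃ₗ[ℂ] B)
    (hSBanti : ∀ b b' : B, SB (b * b') = SB b' * SB b)
    (hSCanti : ∀ c c' : C, SC (c * c') = SC c' * SC c)
    (hSBrel : ∀ b : B, E * (b ⊗ₜ[ℂ] (1 : C)) = E * ((1 : B) ⊗ₜ[ℂ] SB b))
    (hSCrel : ∀ c : C, ((1 : B) ⊗ₜ[ℂ] c) * E = (SC c ⊗ₜ[ℂ] (1 : C)) * E)
 :
    LinearMap.mul' ℂ B (TensorProduct.map LinearMap.id SC.toLinearMap E) = (1 : B) ∧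
    (∀ b : B, (b ⊗ₜ[ℂ] (1 : B)) * TensorProduct.map LinearMap.id SC.toLinearMap E =
      TensorProduct.map LinearMap.id SC.toLinearMap E * ((1 : B) ⊗ₜ[ℂ] b)) := by
  constructor
  · set m := LinearMap.mul' ℂ B (TensorProduct.map LinearMap.id SC.toLinearMap E)
    have hmE : (m ⊗ₜ[ℂ] (1 : C)) * E = E :=
      (mul_eq_mul'_map_tmul_one_mul (S := SC.toLinearMap) hSCrel E).symm.trans hEE
    have hm : LinearMap.mulLeft ℂ m = LinearMap.id := by
      refine LinearMap.ext_on hfullB ?_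
      rintro x ⟨ω, rfl⟩
      rw [LinearMap.mulLeft_apply, ← sL_tmul_one_mul, hmE, LinearMap.id_apply]
    simpa using LinearMap.congr_fun hm 1
  · intro b
    obtain ⟨c, rfl⟩ := SC.surjective b
    rw [← map_tmul_one_mul, ← hSCrel]
    exact map_one_tmul_mul (S := SC.toLinearMap) hSCanti c E
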